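/- Let 0 < p < 1/2. There exists a constant c_p > 0, depending only on p (and on sup_n m_n), such that for every martingale f ∈ H_p(G_m) and every positive integer n, ‖σ_n f‖_{L_p(μ)} ≤ c_p · (M_{|n|} / M_{⟨n⟩})^{1/p − 2} · ‖f‖_{H_p}. -/

import Mathlib

open MeasureTheory Filter
open scoped ENNReal NNReal Real BigOperators

noncomputable section

namespace Vilenkin

instance (k : ℕ) : MeasurableSpace (ZMod k) := ⊤

/-- The Vilenkin group: the product of the cyclic groups `ZMod (m n)`. -/
abbrev G (m : ℕ → ℕ) : Type := ∀ n : ℕ, ZMod (m n)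

variable (m : ℕ → ℕ)

/-- The generalized powers `M_0 = 1`, `M_{n+1} = m_n M_n`. -/
def Mprod : ℕ → ℕ
  | 0 => 1
  | n + 1 => m n * Mprod n

/-- The `k`-th digit of `n` in the base-`M` expansion `n = Σ_k n_k M_k`. -/
def digit (n k : ℕ) : ℕ := (n / Mprod m k) % m k

/-- `⟨n⟩`, the smallest index of a nonzero digit. -/
def lowIdx (n : ℕ) : ℕ := sInf {j | digit m n j ≠ 0}

/-- `|n|`, the largest index of a nonzero digit. -/
def highIdx (n : ℕ) : ℕ := sSup {j | digit m n j ≠ 0}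

/-- Generalized Rademacher functions `r_k(x) = exp(2πi x_k / m_k)`. -/
def rad (k : ℕ) (x : G m) : ℂ :=
  Complex.exp (2 * Real.pi * Complex.I * ((x k).val : ℂ) / (m k : ℂ))

/-- The Vilenkin system `ψ_n = ∏_k r_k^{n_k}`. -/
def psi (n : ℕ) (x : G m) : ℂ :=
  ∏ k ∈ Finset.range (n + 1), rad m k x ^ digit m n k

/-- Dirichlet kernels `D_n = Σ_{k<n} ψ_k`. -/
def Dker (n : ℕ) (x : G m) : ℂ := ∑ k ∈ Finset.range n, psi m k x

/-- Fejér kernels `K_n = (1/n) Σ_{k<n} D_k`. -/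
def Kker (n : ℕ) (x : G m) : ℂ := (n : ℂ)⁻¹ * ∑ k ∈ Finset.range n, Dker m k x

/-- The cylinder `I_n(x)`. -/
def cylinder (n : ℕ) (x : G m) : Set (G m) := {y | ∀ j, j < n → y j = x j}

/-- `e_t`: the element with `t`-th coordinate `1` and all others `0`. -/
def eVec (t : ℕ) : G m := fun j => if j = t then 1 else 0

/-- The filtration `F_n` generated by the cylinders of level `n`. -/
def filtr (n : ℕ) : MeasurableSpace (G m) :=
  MeasurableSpace.comap (fun x (j : Fin n) => x j.val) inferInstance

/-- The normalized Haar measure on `G_m`: the probability measure giving each cylinder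
`I_n(x)` measure `1/M_n`. -/
def IsVilenkinMeasure (μ : Measure (G m)) : Prop :=
  IsProbabilityMeasure μ ∧ ∀ n x, μ (cylinder m n x) = (Mprod m n : ℝ≥0∞)⁻¹

/-- Martingales with respect to the filtration `(F_n)`. -/
def IsMartingale (μ : Measure (G m)) (f : ℕ → G m → ℂ) : Prop :=
  (∀ n, Integrable (f n) μ) ∧
  (∀ n, Measurable[filtr m n] (f n)) ∧
  (∀ n, ∀ s : Set (G m), MeasurableSet[filtr m n] s →
    ∫ x in s, f (n + 1) x ∂μ = ∫ x in s, f n x ∂μ)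

/-- The maximal function `f* = sup_n |f^{(n)}|` (with values in `ℝ≥0∞`). -/
def maximalFn (f : ℕ → G m → ℂ) (x : G m) : ℝ≥0∞ := ⨆ n, (‖f n x‖₊ : ℝ≥0∞)

/-- The martingale Hardy space quasi-norm `‖f‖_{H_p} = ‖f*‖_{L_p}`. -/
def hardyNorm (p : ℝ) (μ : Measure (G m)) (f : ℕ → G m → ℂ) : ℝ≥0∞ :=
  (∫⁻ x, maximalFn m f x ^ p ∂μ) ^ (1 / p)

/-- Vilenkin-Fourier coefficients of an integrable function. -/
def fourierCoeff (μ : Measure (G m)) (g : G m → ℂ) (k : ℕ) : ℂ :=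
  ∫ x, g x * (starRingEnd ℂ) (psi m k x) ∂μ

/-- Partial sums `S_n g` of the Vilenkin-Fourier series of a function. -/
def SFun (μ : Measure (G m)) (g : G m → ℂ) (n : ℕ) (x : G m) : ℂ :=
  ∑ k ∈ Finset.range n, fourierCoeff m μ g k * psi m k x

/-- Fejér means `σ_n g` of a function. -/
def sigmaFun (μ : Measure (G m)) (g : G m → ℂ) (n : ℕ) (x : G m) : ℂ :=
  (n : ℂ)⁻¹ * ∑ k ∈ Finset.range n, SFun m μ g k x

/-- Vilenkin-Fourier coefficients of a martingale:
`f̂(i) = lim_k ∫ f^{(k)} ψ̄_i dμ`. -/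
def martCoeff (μ : Measure (G m)) (f : ℕ → G m → ℂ) (i : ℕ) : ℂ :=
  limUnder atTop fun k => ∫ x, f k x * (starRingEnd ℂ) (psi m i x) ∂μ

/-- Partial sums `S_n f` of the Vilenkin-Fourier series of a martingale. -/
def SMart (μ : Measure (G m)) (f : ℕ → G m → ℂ) (n : ℕ) (x : G m) : ℂ :=
  ∑ k ∈ Finset.range n, martCoeff m μ f k * psi m k x

/-- Fejér means `σ_n f` of a martingale. -/
def sigmaMart (μ : Measure (G m)) (f : ℕ → G m → ℂ) (n : ℕ) (x : G m) : ℂ :=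
  (n : ℂ)⁻¹ * ∑ k ∈ Finset.range n, SMart m μ f k x

/-- The weak `L_p` quasi-norm `‖g‖_{L_{p,∞}} = (sup_λ λ^p μ(|g|>λ))^{1/p}`. -/
def weakNorm (p : ℝ) (μ : Measure (G m)) (g : G m → ℂ) : ℝ≥0∞ :=
  (⨆ lam : ℝ≥0, (lam : ℝ≥0∞) ^ p * μ {x | (lam : ℝ) < ‖g x‖}) ^ (1 / p)

/-- A `p`-atom with prescribed support interval `I_N(x₀)`. -/
def IsPAtomAt (p : ℝ) (μ : Measure (G m)) (N : ℕ) (x₀ : G m) (a : G m → ℂ) : Prop :=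
  Measurable a ∧ Function.support a ⊆ cylinder m N x₀ ∧
    (∫ x in cylinder m N x₀, a x ∂μ) = 0 ∧
    eLpNorm a ⊤ μ ≤ μ (cylinder m N x₀) ^ (-(1 / p))

/-- A `p`-atom. -/
def IsPAtom (p : ℝ) (μ : Measure (G m)) (a : G m → ℂ) : Prop :=
  ∃ N x₀, IsPAtomAt m p μ N x₀ a

/-- The sets `I_N^{i,j}` for `i < j ≤ N`. -/
def IsetIJ (N i j : ℕ) : Set (G m) :=
  if j < N then
    {x | (∀ l, l < i → x l = 0) ∧ x i ≠ 0 ∧ (∀ l, i < l → l < j → x l = 0) ∧ x j ≠ 0}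
  else
    {x | (∀ l, l < i → x l = 0) ∧ x i ≠ 0 ∧ (∀ l, i < l → l < N → x l = 0)}

section Digits

variable {m}

lemma Mprod_succ (n : ℕ) : Mprod m (n + 1) = m n * Mprod m n := rfl

lemma Mprod_pos [∀ n, NeZero (m n)] (n : ℕ) : 0 < Mprod m n := by
  induction n with
  | zero => exact Nat.one_pos
  | succ n ih => exact Nat.mul_pos (Nat.pos_of_neZero _) ih

lemma Mprod_dvd {a b : ℕ} (h : a ≤ b) : Mprod m a ∣ Mprod m b := by
  induction b, h using Nat.le_induction with
  | base => exact dvd_rfl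
  | succ b _ ih => exact ih.trans (Dvd.intro_left _ rfl)

lemma Mprod_le [∀ n, NeZero (m n)] {a b : ℕ} (h : a ≤ b) : Mprod m a ≤ Mprod m b :=
  Nat.le_of_dvd (Mprod_pos b) (Mprod_dvd h)

lemma lt_Mprod (hm : ∀ n, 2 ≤ m n) (n : ℕ) : n < Mprod m n := by
  induction n with
  | zero => exact Nat.one_pos
  | succ n ih =>
    rw [Mprod_succ]
    nlinarith [hm n]

lemma digit_eq_zero_of_lt {n k : ℕ} (h : n < Mprod m k) : digit m n k = 0 := by
  simp [digit, Nat.div_eq_of_lt h]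

lemma digit_eq_zero_of_dvd [∀ n, NeZero (m n)] {q A j : ℕ} (hq : Mprod m A ∣ q) (hj : j < A) :
    digit m q j = 0 := by
  obtain ⟨c, hc⟩ := (Mprod_dvd (m := m) (Nat.succ_le_of_lt hj)).trans hq
  rw [digit, hc, Nat.succ_eq_add_one, Mprod_succ,
    show m j * Mprod m j * c = Mprod m j * (m j * c) by ring,
    Nat.mul_div_cancel_left _ (Mprod_pos j), Nat.mul_mod_right]

lemma digit_add [∀ n, NeZero (m n)] {q k A : ℕ} (hq : Mprod m A ∣ q) (hk : k < Mprod m A)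
    (j : ℕ) : digit m (q + k) j = digit m q j + digit m k j := by
  rcases lt_or_ge j A with hj | hj
  · obtain ⟨c, hc⟩ := (Mprod_dvd (m := m) (Nat.succ_le_of_lt hj)).trans hq
    rw [digit_eq_zero_of_dvd hq hj, zero_add, digit, digit, hc, Nat.succ_eq_add_one, Mprod_succ,
      show m j * Mprod m j * c + k = k + Mprod m j * (m j * c) by ring,
      Nat.add_mul_div_left _ _ (Mprod_pos j), Nat.add_mul_mod_self_left]
  · rw [digit_eq_zero_of_lt (hk.trans_le (Mprod_le hj)), add_zero, digit, digit]
    obtain ⟨d, hd⟩ := Mprod_dvd (m := m) hj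
    obtain ⟨c, hc⟩ := hq
    rw [hd, ← Nat.div_div_eq_div_mul, ← Nat.div_div_eq_div_mul, hc, add_comm,
      Nat.add_mul_div_left _ _ (Mprod_pos A), Nat.div_eq_of_lt hk, zero_add,
      Nat.mul_div_cancel_left _ (Mprod_pos A)]

lemma exists_Mprod_le_lt (hm : ∀ n, 2 ≤ m n) {n : ℕ} (hn : 0 < n) :
    ∃ r, Mprod m r ≤ n ∧ n < Mprod m (r + 1) := by
  classical
  have hex : ∃ r, n < Mprod m r := ⟨n, lt_Mprod hm n⟩
  have h0 : Nat.find hex ≠ 0 := fun h => by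
    have := Nat.find_spec hex
    rw [h] at this
    exact absurd hn (by simpa [Mprod] using this)
  obtain ⟨r, hr⟩ := Nat.exists_eq_succ_of_ne_zero h0
  refine ⟨r, not_lt.1 (Nat.find_min hex (hr ▸ Nat.lt_succ_self r)), ?_⟩
  have := Nat.find_spec hex
  rwa [hr] at this

lemma Mprod_highIdx (hm : ∀ n, 2 ≤ m n) {n : ℕ} (hn : 0 < n) :
    Mprod m (highIdx m n) ≤ n ∧ n < Mprod m (highIdx m n + 1) := by
  have : ∀ n, NeZero (m n) := fun n => ⟨by have := hm n; omega⟩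
  obtain ⟨r, hr, hr'⟩ := exists_Mprod_le_lt hm hn
  have : IsGreatest {j | digit m n j ≠ 0} r := by
    constructor
    · have h1 : 1 ≤ n / Mprod m r := (Nat.one_le_div_iff (Mprod_pos r)).2 hr
      have h2 : n / Mprod m r < m r := Nat.div_lt_of_lt_mul (by rwa [Mprod_succ, mul_comm] at hr')
      simp only [Set.mem_ofPred_eq, digit, Nat.mod_eq_of_lt h2]
      omega
    · intro j hj
      by_contra! hlt
      exact hj (digit_eq_zero_of_lt (hr'.trans_le (Mprod_le hlt)))
  rw [highIdx, this.csSup_eq]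
  exact ⟨hr, hr'⟩

lemma Mprod_lowIdx_dvd [∀ n, NeZero (m n)] (n : ℕ) : Mprod m (lowIdx m n) ∣ n := by
  suffices ∀ j ≤ lowIdx m n, Mprod m j ∣ n from this _ le_rfl
  intro j
  induction j with
  | zero => exact fun _ => one_dvd _
  | succ j ih =>
    intro hj
    have h0 : digit m n j = 0 := by
      by_contra h
      exact absurd (Nat.sInf_le (s := {j | digit m n j ≠ 0}) h) (not_le.2 hj)
    obtain ⟨c, hc⟩ := ih (by omega)
    rw [digit, hc, Nat.mul_div_cancel_left _ (Mprod_pos j)] at h0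
    obtain ⟨d, hd⟩ := Nat.dvd_of_mod_eq_zero h0
    exact ⟨d, by rw [hc, hd, Mprod_succ]; ring⟩

end Digits

section Characters

variable {m}

lemma psi_zero (x : G m) : psi m 0 x = 1 := by simp [psi, digit]

variable [∀ n, NeZero (m n)]

lemma rad_eq_stdAddChar (k : ℕ) (x : G m) : rad m k x = ZMod.stdAddChar (x k) := by
  rw [ZMod.stdAddChar_apply, ZMod.toCircle_apply, rad]

lemma rad_sub (k : ℕ) (x y : G m) :
    rad m k (x - y) = rad m k x * (starRingEnd ℂ) (rad m k y) := by
  rw [rad_eq_stdAddChar, rad_eq_stdAddChar, rad_eq_stdAddChar, Pi.sub_apply, sub_eq_add_neg,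
    AddChar.map_add_eq_mul, AddChar.map_neg_eq_conj]

lemma norm_rad (k : ℕ) (x : G m) : ‖rad m k x‖ = 1 := by
  rw [rad_eq_stdAddChar, ZMod.stdAddChar_apply, Circle.norm_coe]

lemma sum_rad_pow_eq_zero {k : ℕ} {x : G m} (hx : x k ≠ 0) :
    ∑ c ∈ Finset.range (m k), rad m k x ^ c = 0 := by
  have h1 : rad m k x ≠ 1 := fun h => hx <| by
    rw [rad_eq_stdAddChar, ← (ZMod.stdAddChar (N := m k)).map_zero_eq_one] at h
    exact ZMod.injective_stdAddChar h
  rw [geom_sum_eq h1, rad_eq_stdAddChar, ← AddChar.map_nsmul_eq_pow]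
  simp

lemma psi_eq_prod (hm : ∀ n, 2 ≤ m n) {n L : ℕ} (h : n < Mprod m L) (x : G m) :
    psi m n x = ∏ k ∈ Finset.range L, rad m k x ^ digit m n k := by
  have key : ∀ a b, n < Mprod m a → a ≤ b → ∏ k ∈ Finset.range a, rad m k x ^ digit m n k
      = ∏ k ∈ Finset.range b, rad m k x ^ digit m n k := fun a b ha hab =>
    Finset.prod_subset (Finset.range_mono hab) fun k _ hk => by
      rw [digit_eq_zero_of_lt (ha.trans_le (Mprod_le (by simpa using hk))), pow_zero]
  have hn : n < Mprod m (n + 1) := (Nat.lt_succ_self n).trans (lt_Mprod hm (n + 1))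
  rcases le_total L (n + 1) with hL | hL
  · exact (key _ _ h hL).symm
  · exact key _ _ hn hL

lemma norm_psi (n : ℕ) (x : G m) : ‖psi m n x‖ = 1 := by
  simp [psi, norm_prod, norm_rad]

lemma psi_sub (n : ℕ) (x y : G m) :
    psi m n (x - y) = psi m n x * (starRingEnd ℂ) (psi m n y) := by
  simp only [psi, rad_sub, mul_pow, Finset.prod_mul_distrib, map_prod, map_pow]

lemma psi_add (hm : ∀ n, 2 ≤ m n) {q k A : ℕ} (hq : Mprod m A ∣ q) (hk : k < Mprod m A)
    (x : G m) : psi m (q + k) x = psi m q x * psi m k x := by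
  have hL := lt_Mprod hm (q + k)
  rw [psi_eq_prod hm hL, psi_eq_prod hm (lt_of_le_of_lt (Nat.le_add_right q k) hL),
    psi_eq_prod hm (lt_of_le_of_lt (Nat.le_add_left k q) hL), ← Finset.prod_mul_distrib]
  simp only [digit_add hq hk, pow_add]

lemma psi_mul_Mprod (hm : ∀ n, 2 ≤ m n) {c A : ℕ} (hc : c < m A) (x : G m) :
    psi m (c * Mprod m A) x = rad m A x ^ c := by
  have h : c * Mprod m A < Mprod m (A + 1) := Nat.mul_lt_mul_of_pos_right hc (Mprod_pos A)
  rw [psi_eq_prod hm h, Finset.prod_range_succ, Finset.prod_eq_one, one_mul, digit,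
    Nat.mul_div_cancel _ (Mprod_pos A), Nat.mod_eq_of_lt hc]
  intro j hj
  rw [digit_eq_zero_of_dvd (Dvd.intro_left c rfl) (Finset.mem_range.1 hj), pow_zero]

lemma psi_congr (hm : ∀ n, 2 ≤ m n) {n L : ℕ} (h : n < Mprod m L) {x y : G m}
    (hxy : ∀ j < L, x j = y j) : psi m n x = psi m n y := by
  rw [psi_eq_prod hm h, psi_eq_prod hm h]
  refine Finset.prod_congr rfl fun j hj => ?_
  rw [rad, rad, hxy j (Finset.mem_range.1 hj)]

end Characters

section Kernels

variable {m}

/-- The unnormalized Fejér kernel `n K_n = Σ_{k<n} D_k`. -/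
def fejerSum (m : ℕ → ℕ) (n : ℕ) (x : G m) : ℂ := ∑ k ∈ Finset.range n, Dker m k x

lemma Dker_congr [∀ n, NeZero (m n)] (hm : ∀ n, 2 ≤ m n) {n L : ℕ} (h : n ≤ Mprod m L)
    {x y : G m} (hxy : ∀ j < L, x j = y j) : Dker m n x = Dker m n y :=
  Finset.sum_congr rfl fun _ hk => psi_congr hm ((Finset.mem_range.1 hk).trans_le h) hxy

lemma fejerSum_congr [∀ n, NeZero (m n)] (hm : ∀ n, 2 ≤ m n) {n L : ℕ} (h : n ≤ Mprod m L)
    {x y : G m} (hxy : ∀ j < L, x j = y j) : fejerSum m n x = fejerSum m n y :=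
  Finset.sum_congr rfl fun _ hk => Dker_congr hm ((Finset.mem_range.1 hk).le.trans h) hxy

variable [∀ n, NeZero (m n)]

lemma Dker_add (hm : ∀ n, 2 ≤ m n) {q k A : ℕ} (hq : Mprod m A ∣ q) (hk : k ≤ Mprod m A)
    (x : G m) : Dker m (q + k) x = Dker m q x + psi m q x * Dker m k x := by
  rw [Dker, Finset.sum_range_add, Dker, Dker, Finset.mul_sum]
  congr 1
  exact Finset.sum_congr rfl fun i hi => psi_add hm hq ((Finset.mem_range.1 hi).trans_le hk) x

lemma fejerSum_add (hm : ∀ n, 2 ≤ m n) {q k A : ℕ} (hq : Mprod m A ∣ q) (hk : k ≤ Mprod m A)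
    (x : G m) :
    fejerSum m (q + k) x = fejerSum m q x + k * Dker m q x + psi m q x * fejerSum m k x := by
  rw [fejerSum, Finset.sum_range_add, fejerSum, fejerSum, Finset.mul_sum, add_assoc]
  congr 1
  rw [Finset.sum_congr rfl fun i hi =>
    Dker_add hm hq ((Finset.mem_range.1 hi).le.trans hk) x, Finset.sum_add_distrib]
  simp

lemma Dker_mul_Mprod (hm : ∀ n, 2 ≤ m n) {A b : ℕ} (hb : b ≤ m A) (x : G m) :
    Dker m (b * Mprod m A) x = (∑ c ∈ Finset.range b, rad m A x ^ c) * Dker m (Mprod m A) x := by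
  induction b with
  | zero => simp [Dker]
  | succ b ih =>
    rw [add_mul, one_mul, Dker_add hm (Dvd.intro_left b rfl) le_rfl, ih (by omega),
      psi_mul_Mprod hm hb, Finset.sum_range_succ, add_mul]

lemma fejerSum_mul_Mprod (hm : ∀ n, 2 ≤ m n) {A b : ℕ} (hb : b ≤ m A) (x : G m) :
    fejerSum m (b * Mprod m A) x =
      ∑ c ∈ Finset.range b, (Mprod m A : ℂ) * Dker m (c * Mprod m A) x +
        (∑ c ∈ Finset.range b, rad m A x ^ c) * fejerSum m (Mprod m A) x := by
  induction b with
  | zero => simp [fejerSum]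
  | succ b ih =>
    rw [add_mul, one_mul, fejerSum_add hm (Dvd.intro_left b rfl) le_rfl, ih (by omega),
      psi_mul_Mprod hm hb, Finset.sum_range_succ, Finset.sum_range_succ]
    ring

end Kernels

section Averages

variable {m}

/-- Extension by zero of an element of the finite quotient `∏_{j<L} ZMod (m j)`. -/
def extendZero (L : ℕ) (z : ∀ j : Fin L, ZMod (m j)) : G m :=
  fun j => if h : j < L then z ⟨j, h⟩ else 0

lemma extendZero_of_lt {L j : ℕ} (h : j < L) (z : ∀ j : Fin L, ZMod (m j)) :
    extendZero L z j = z ⟨j, h⟩ := dif_pos h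

lemma extendZero_of_le {L j : ℕ} (h : L ≤ j) (z : ∀ j : Fin L, ZMod (m j)) :
    extendZero L z j = 0 := dif_neg (not_lt.2 h)

lemma extendZero_add {L : ℕ} {y : G m} (hy : ∀ j, L ≤ j → y j = 0)
    (z : ∀ j : Fin L, ZMod (m j)) :
    extendZero L z + y = extendZero L (z + fun j : Fin L => y j) := by
  ext j
  rcases lt_or_ge j L with h | h
  · simp [extendZero_of_lt h]
  · simp [extendZero_of_le h, hy j h]

variable [∀ n, NeZero (m n)]

/-- The average of `F` over the representatives of the cylinders of level `L`. -/
def avg (L : ℕ) (F : G m → ℝ) : ℝ :=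
  (Mprod m L : ℝ)⁻¹ * ∑ z : (∀ j : Fin L, ZMod (m j)), F (extendZero L z)

lemma avg_mono {L : ℕ} {F H : G m → ℝ} (h : ∀ x, F x ≤ H x) : avg L F ≤ avg L H := by
  unfold avg
  gcongr
  exact h _

lemma avg_nonneg {L : ℕ} {F : G m → ℝ} (h : ∀ x, 0 ≤ F x) : 0 ≤ avg L F :=
  mul_nonneg (by positivity) (Finset.sum_nonneg fun _ _ => h _)

lemma avg_add (L : ℕ) (F H : G m → ℝ) : avg L (fun x => F x + H x) = avg L F + avg L H := by
  simp only [avg, Finset.sum_add_distrib, mul_add]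

lemma avg_const_mul (L : ℕ) (a : ℝ) (F : G m → ℝ) :
    avg L (fun x => a * F x) = a * avg L F := by
  simp only [avg, ← Finset.mul_sum]
  ring

lemma avg_sum {ι : Type*} (s : Finset ι) (L : ℕ) (F : ι → G m → ℝ) :
    avg L (fun x => ∑ i ∈ s, F i x) = ∑ i ∈ s, avg L (F i) := by
  simp only [avg, ← Finset.mul_sum]
  rw [Finset.sum_comm]

lemma card_quotient (L : ℕ) : Fintype.card (∀ j : Fin L, ZMod (m j)) = Mprod m L := by
  rw [Fintype.card_pi]
  simp only [ZMod.card]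
  rw [Fin.prod_univ_eq_prod_range m L]
  induction L with
  | zero => rfl
  | succ L ih => rw [Finset.prod_range_succ, ih, Mprod_succ, mul_comm]

lemma avg_one (L : ℕ) : avg L (fun _ : G m => 1) = 1 := by
  have : (Mprod m L : ℝ) ≠ 0 := by exact_mod_cast (Mprod_pos L).ne'
  rw [avg, Finset.sum_const, Finset.card_univ, card_quotient, nsmul_eq_mul, mul_one,
    inv_mul_cancel₀ this]

lemma avg_translate {L : ℕ} {y : G m} (hy : ∀ j, L ≤ j → y j = 0) (F : G m → ℝ) :
    avg L (fun x => F (x + y)) = avg L F := by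
  simp only [avg, extendZero_add hy]
  congr 1
  exact Equiv.sum_comp (Equiv.addRight fun j : Fin L => y j) fun z => F (extendZero L z)

lemma avg_indicator {L A : ℕ} (hA : A < L) {F : G m → ℝ}
    (hF : ∀ (x : G m) (a : ZMod (m A)), F (x + Pi.single A a) = F x) :
    avg L (fun x => if x A = 0 then F x else 0) = (m A : ℝ)⁻¹ * avg L F := by
  have h1 : avg L F = ∑ a : ZMod (m A), avg L (fun x => if x A = a then F x else 0) := by
    rw [← avg_sum]
    simp
  have h2 : ∀ a : ZMod (m A), avg L (fun x => if x A = a then F x else 0) =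
      avg L (fun x => if x A = 0 then F x else 0) := by
    intro a
    have hy : ∀ j, L ≤ j → (Pi.single A a : G m) j = 0 := fun j hj => by
      rw [Pi.single_eq_of_ne (show j ≠ A by omega)]
    rw [← avg_translate hy]
    simp [hF]
  have h3 : (m A : ℝ) ≠ 0 := by exact_mod_cast NeZero.ne (m A)
  rw [h1, Finset.sum_congr rfl fun a _ => h2 a, Finset.sum_const, Finset.card_univ, ZMod.card,
    nsmul_eq_mul, inv_mul_cancel_left₀ h3]

end Averages

section PowerMeans

variable {m} [∀ n, NeZero (m n)]

/-- The average of `‖g‖ ^ p` over the cylinders of level `L`. -/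
def meanPow (p : ℝ) (L : ℕ) (g : G m → ℂ) : ℝ := avg L fun x => ‖g x‖ ^ p

lemma meanPow_nonneg (p : ℝ) (L : ℕ) (g : G m → ℂ) : 0 ≤ meanPow p L g :=
  avg_nonneg fun _ => by positivity

lemma meanPow_add_le {p : ℝ} (hp0 : 0 ≤ p) (hp1 : p ≤ 1) (L : ℕ) (g h : G m → ℂ) :
    meanPow p L (fun x => g x + h x) ≤ meanPow p L g + meanPow p L h := by
  rw [meanPow, meanPow, meanPow, ← avg_add]
  exact avg_mono fun x => (Real.rpow_le_rpow (norm_nonneg _) (norm_add_le _ _) hp0).trans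
    (Real.rpow_add_le_add_rpow (norm_nonneg _) (norm_nonneg _) hp0 hp1)

lemma norm_sum_rpow_le {ι E : Type*} [SeminormedAddCommGroup E] {p : ℝ} (hp0 : 0 < p)
    (hp1 : p ≤ 1) (s : Finset ι) (g : ι → E) : ‖∑ i ∈ s, g i‖ ^ p ≤ ∑ i ∈ s, ‖g i‖ ^ p := by
  classical
  induction s using Finset.induction_on with
  | empty => simp [Real.zero_rpow hp0.ne']
  | insert i s hi ih =>
    rw [Finset.sum_insert hi, Finset.sum_insert hi]
    calc ‖g i + ∑ j ∈ s, g j‖ ^ p ≤ (‖g i‖ + ‖∑ j ∈ s, g j‖) ^ p :=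
          Real.rpow_le_rpow (norm_nonneg _) (norm_add_le _ _) hp0.le
      _ ≤ ‖g i‖ ^ p + ‖∑ j ∈ s, g j‖ ^ p :=
          Real.rpow_add_le_add_rpow (norm_nonneg _) (norm_nonneg _) hp0.le hp1
      _ ≤ _ := by gcongr

lemma meanPow_sum_le {ι : Type*} {p : ℝ} (hp0 : 0 < p) (hp1 : p ≤ 1) (L : ℕ) (s : Finset ι)
    (g : ι → G m → ℂ) :
    meanPow p L (fun x => ∑ i ∈ s, g i x) ≤ ∑ i ∈ s, meanPow p L (g i) := by
  simp only [meanPow]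
  rw [← avg_sum]
  exact avg_mono fun x => norm_sum_rpow_le hp0 hp1 s _

lemma meanPow_unimodular_mul (p : ℝ) (L : ℕ) {u : G m → ℂ} (hu : ∀ x, ‖u x‖ = 1)
    (g : G m → ℂ) : meanPow p L (fun x => u x * g x) = meanPow p L g := by
  simp only [meanPow, norm_mul, hu, one_mul]

lemma meanPow_natCast_mul (p : ℝ) (L k : ℕ) (g : G m → ℂ) :
    meanPow p L (fun x => k * g x) = (k : ℝ) ^ p * meanPow p L g := by
  rw [meanPow, meanPow, ← avg_const_mul]
  simp [Real.mul_rpow]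

lemma meanPow_sum_rad_le {p : ℝ} (hp0 : 0 < p) (hp1 : p ≤ 1) (L A b : ℕ) (g : G m → ℂ) :
    meanPow p L (fun x => (∑ c ∈ Finset.range b, rad m A x ^ c) * g x) ≤ b * meanPow p L g := by
  simp only [Finset.sum_mul]
  refine (meanPow_sum_le hp0 hp1 L _ _).trans ?_
  rw [Finset.sum_congr rfl fun c _ => meanPow_unimodular_mul p L (u := fun x => rad m A x ^ c)
    (fun x => by rw [norm_pow, norm_rad, one_pow]) g]
  simp

lemma meanPow_sum_rad_full_le {p : ℝ} (hp0 : 0 < p) {L A : ℕ} (hA : A < L)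
    {g : G m → ℂ} (hg : ∀ (x : G m) (a : ZMod (m A)), g (x + Pi.single A a) = g x) :
    meanPow p L (fun x => (∑ c ∈ Finset.range (m A), rad m A x ^ c) * g x) ≤
      (m A : ℝ) ^ (p - 1) * meanPow p L g := by
  have hm0 : (0 : ℝ) < m A := by exact_mod_cast Nat.pos_of_neZero (m A)
  rw [Real.rpow_sub_one hm0.ne', div_mul_eq_mul_div, mul_div_assoc, div_eq_inv_mul, meanPow,
    meanPow, ← avg_indicator hA (fun x a => by rw [hg]), ← avg_const_mul]
  refine avg_mono fun x => ?_
  split_ifs with hx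
  · rw [norm_mul, Real.mul_rpow (norm_nonneg _) (norm_nonneg _)]
    gcongr
    refine (norm_sum_le _ _).trans ?_
    simp [norm_rad]
  · rw [sum_rad_pow_eq_zero hx]
    simp [Real.zero_rpow hp0.ne']

end PowerMeans

section KernelBounds

variable {m}

lemma add_single_apply_of_lt {A j : ℕ} (h : j < A) (x : G m) (a : ZMod (m A)) :
    (x + Pi.single A a : G m) j = x j := by
  rw [Pi.add_apply, Pi.single_eq_of_ne h.ne, add_zero]

lemma Mprod_succ_rpow_le (hm : ∀ n, 2 ≤ m n) {r : ℝ} (hr : r ≤ 0) (A : ℕ) :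
    (Mprod m (A + 1) : ℝ) ^ r ≤ 2 ^ r * (Mprod m A : ℝ) ^ r := by
  rw [Mprod_succ, Nat.cast_mul, Real.mul_rpow (by positivity) (by positivity)]
  exact mul_le_mul_of_nonneg_right
    (Real.rpow_le_rpow_of_nonpos two_pos (by exact_mod_cast hm A) hr) (by positivity)

variable [∀ n, NeZero (m n)]

lemma meanPow_Dker_Mprod_le (hm : ∀ n, 2 ≤ m n) {p : ℝ} (hp0 : 0 < p) {L A : ℕ} (hA : A ≤ L) :
    meanPow p L (Dker m (Mprod m A)) ≤ (Mprod m A : ℝ) ^ (p - 1) := by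
  induction A with
  | zero =>
    have : ∀ x : G m, Dker m 1 x = 1 := fun x => by simp [Dker, psi_zero]
    simp [Mprod, meanPow, this, avg_one]
  | succ A ih =>
    have h1 : Dker m (Mprod m (A + 1)) = fun x =>
        (∑ c ∈ Finset.range (m A), rad m A x ^ c) * Dker m (Mprod m A) x :=
      funext fun x => Dker_mul_Mprod hm le_rfl x
    rw [h1, Mprod_succ, Nat.cast_mul, Real.mul_rpow (by positivity) (by positivity)]
    refine (meanPow_sum_rad_full_le hp0 hA fun x a => ?_).trans ?_
    · exact Dker_congr hm le_rfl fun j hj => add_single_apply_of_lt hj x a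
    · gcongr
      exact ih (by omega)

/-- Peeling off the lowest base-`M` digit of a multiple of `M_A`. -/
lemma exists_eq_add_mul_Mprod {A q : ℕ} (hq : Mprod m A ∣ q) :
    ∃ q' b, Mprod m (A + 1) ∣ q' ∧ b < m A ∧ q = q' + b * Mprod m A := by
  obtain ⟨c, rfl⟩ := hq
  refine ⟨Mprod m (A + 1) * (c / m A), c % m A, dvd_mul_right _ _,
    Nat.mod_lt _ (Nat.pos_of_neZero _), ?_⟩
  conv_lhs => rw [← Nat.div_add_mod c (m A)]
  rw [Mprod_succ]
  ring

lemma le_of_geometric_step {r C K x y : ℝ} (hC : C * (1 - 2 ^ r) = K)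
    (hC0 : 0 ≤ C) (hy : y ≤ 2 ^ r * x) : K * x + C * y ≤ C * x := by
  have := mul_le_mul_of_nonneg_left hy hC0
  rw [← hC]
  linarith

lemma one_sub_two_rpow_pos {r : ℝ} (hr : r < 0) : 0 < 1 - (2 : ℝ) ^ r :=
  sub_pos.2 (Real.rpow_lt_one_of_one_lt_of_neg one_lt_two hr)

lemma meanPow_Dker_le (hm : ∀ n, 2 ≤ m n) {B : ℕ} (hB : ∀ n, m n ≤ B) {p : ℝ} (hp0 : 0 < p)
    (hp1 : p < 1) :
    ∃ C : ℝ, 0 ≤ C ∧ ∀ L A q : ℕ, Mprod m A ∣ q → q < Mprod m L → A ≤ L →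
      meanPow p L (Dker m q) ≤ C * (Mprod m A : ℝ) ^ (p - 1) := by
  have hr : p - 1 < 0 := by linarith
  have h2 := one_sub_two_rpow_pos hr
  refine ⟨B / (1 - 2 ^ (p - 1)), by positivity, ?_⟩
  intro L A q hq hqL hA
  induction hA using Nat.decreasingInduction generalizing q with
  | self =>
    have : ∀ x, Dker m 0 x = 0 := fun x => by simp [Dker]
    rw [Nat.eq_zero_of_dvd_of_lt hq hqL, meanPow]
    simp only [this, norm_zero, Real.zero_rpow hp0.ne']
    have : avg (m := m) L (fun _ => 0) = 0 := by simp [avg]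
    rw [this]
    positivity
  | of_succ A hA ih =>
    obtain ⟨q', b, hq', hb, rfl⟩ := exists_eq_add_mul_Mprod hq
    have hbM : b * Mprod m A ≤ Mprod m (A + 1) := Nat.mul_le_mul_right _ hb.le
    have h1 : Dker m (q' + b * Mprod m A) = fun x => Dker m q' x +
        psi m q' x * ((∑ c ∈ Finset.range b, rad m A x ^ c) * Dker m (Mprod m A) x) :=
      funext fun x => by rw [Dker_add hm hq' hbM, Dker_mul_Mprod hm hb.le]
    rw [h1]
    refine (meanPow_add_le hp0.le hp1.le L _ _).trans ?_
    rw [meanPow_unimodular_mul p L (norm_psi q'), add_comm]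
    refine le_trans (add_le_add ?_ (ih q' hq' (by omega)))
      (le_of_geometric_step (K := B) (by field_simp) (by positivity)
        (Mprod_succ_rpow_le hm hr.le A))
    refine (meanPow_sum_rad_le hp0 hp1.le L A b _).trans ?_
    have hbB : (b : ℝ) ≤ B := by exact_mod_cast hb.le.trans (hB A)
    exact mul_le_mul hbB (meanPow_Dker_Mprod_le hm hp0 hA.le) (meanPow_nonneg _ _ _)
      (Nat.cast_nonneg _)

lemma meanPow_fejerSum_zero {p : ℝ} (hp0 : 0 < p) (L : ℕ) :
    meanPow p L (fejerSum m 0) = 0 := by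
  simp [meanPow, avg, fejerSum, Real.zero_rpow hp0.ne']

lemma meanPow_sum_Dker_le {p : ℝ} (hp0 : 0 < p) (hp1 : p ≤ 1)
    {L A b B : ℕ} {C : ℝ} (hb : b ≤ m A) (hbB : b ≤ B) (hA : A < L)
    (hC0 : 0 ≤ C) (hC : ∀ q : ℕ, Mprod m A ∣ q → q < Mprod m L →
      meanPow p L (Dker m q) ≤ C * (Mprod m A : ℝ) ^ (p - 1)) :
    meanPow p L (fun x => ∑ c ∈ Finset.range b, (Mprod m A : ℂ) * Dker m (c * Mprod m A) x) ≤
      B * C * (Mprod m A : ℝ) ^ (2 * p - 1) := by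
  have hM : (0 : ℝ) < Mprod m A := by exact_mod_cast Mprod_pos A
  refine (meanPow_sum_le hp0 hp1 L _ _).trans ?_
  refine (Finset.sum_le_card_nsmul _ _ (C * (Mprod m A : ℝ) ^ (2 * p - 1)) ?_).trans ?_
  · intro c hc
    have hlt : c * Mprod m A < Mprod m L :=
      (Nat.mul_lt_mul_of_pos_right ((Finset.mem_range.1 hc).trans_le hb) (Mprod_pos A)).trans_le
        (Mprod_le (m := m) hA)
    rw [meanPow_natCast_mul, show 2 * p - 1 = p + (p - 1) by ring, Real.rpow_add hM,
      mul_left_comm C]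
    gcongr
    exact hC _ (Dvd.intro_left c rfl) hlt
  · rw [Finset.card_range, nsmul_eq_mul, mul_assoc]
    gcongr

lemma meanPow_fejerSum_Mprod_le (hm : ∀ n, 2 ≤ m n) {B : ℕ} (hB : ∀ n, m n ≤ B) {p : ℝ}
    (hp0 : 0 < p) (hp : p < 1 / 2) :
    ∃ C : ℝ, 0 ≤ C ∧ ∀ L A : ℕ, A ≤ L →
      meanPow p L (fejerSum m (Mprod m A)) ≤ C * (Mprod m A : ℝ) ^ (2 * p - 1) := by
  obtain ⟨C, hC0, hC⟩ := meanPow_Dker_le hm hB hp0 (by linarith)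
  have hB0 : (0 : ℝ) < B := by exact_mod_cast (Nat.pos_of_neZero (m 0)).trans_le (hB 0)
  have h2 := one_sub_two_rpow_pos (neg_lt_zero.2 hp0)
  set K : ℝ := B * C * (B : ℝ) ^ (1 - 2 * p)
  refine ⟨K / (1 - 2 ^ (-p)), by positivity, ?_⟩
  intro L A hA
  induction A with
  | zero =>
    have : fejerSum m (Mprod m 0) = fun _ => 0 := by
      funext x
      simp [fejerSum, Mprod, Dker]
    rw [this, meanPow]
    simp only [norm_zero, Real.zero_rpow hp0.ne']
    have : avg (m := m) L (fun _ => 0) = 0 := by simp [avg]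
    rw [this]
    positivity
  | succ A ih =>
    have h1 : fejerSum m (Mprod m (A + 1)) = fun x =>
        ∑ c ∈ Finset.range (m A), (Mprod m A : ℂ) * Dker m (c * Mprod m A) x +
          (∑ c ∈ Finset.range (m A), rad m A x ^ c) * fejerSum m (Mprod m A) x :=
      funext fun x => fejerSum_mul_Mprod hm le_rfl x
    have hm0 : (0 : ℝ) < m A := by exact_mod_cast Nat.pos_of_neZero (m A)
    have hM : (0 : ℝ) < Mprod m A := by exact_mod_cast Mprod_pos A
    rw [h1]
    refine (meanPow_add_le hp0.le (by linarith) L _ _).trans ?_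
    have hfirst : B * C * (Mprod m A : ℝ) ^ (2 * p - 1) ≤
        K * (Mprod m (A + 1) : ℝ) ^ (2 * p - 1) := by
      rw [Mprod_succ, Nat.cast_mul, Real.mul_rpow hm0.le hM.le, ← mul_assoc]
      refine mul_le_mul_of_nonneg_right ?_ (by positivity)
      rw [mul_assoc]
      refine le_mul_of_one_le_right (by positivity) ?_
      rw [← neg_sub, Real.rpow_neg hB0.le, ← div_eq_inv_mul, one_le_div (by positivity)]
      exact Real.rpow_le_rpow_of_nonpos hm0 (by exact_mod_cast hB A) (by linarith)
    have hsecond : (m A : ℝ) ^ (p - 1) * (Mprod m A : ℝ) ^ (2 * p - 1) ≤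
        2 ^ (-p) * (Mprod m (A + 1) : ℝ) ^ (2 * p - 1) := by
      rw [Mprod_succ, Nat.cast_mul, Real.mul_rpow hm0.le hM.le, ← mul_assoc,
        show p - 1 = -p + (2 * p - 1) by ring, Real.rpow_add hm0]
      refine mul_le_mul_of_nonneg_right (mul_le_mul_of_nonneg_right ?_ (by positivity))
        (by positivity)
      exact Real.rpow_le_rpow_of_nonpos two_pos (by exact_mod_cast hm A) (by linarith)
    refine le_trans (add_le_add
      ((meanPow_sum_Dker_le hp0 (by linarith) le_rfl (hB A) hA hC0
        fun q hq hqL => hC L A q hq hqL (by omega)).trans hfirst)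
      ((meanPow_sum_rad_full_le hp0 hA fun x a =>
        fejerSum_congr hm le_rfl fun j hj => add_single_apply_of_lt hj x a).trans
        ((mul_le_mul_of_nonneg_left (ih (by omega)) (by positivity)).trans_eq
          (mul_left_comm _ _ _))))
      (le_of_geometric_step (by field_simp) (by positivity) hsecond)

/-- The unnormalized Fejér kernel satisfies `∫ |n K_n|^p ≤ C M_{⟨n⟩}^{2p-1}`. -/
lemma meanPow_fejerSum_le (hm : ∀ n, 2 ≤ m n) {B : ℕ} (hB : ∀ n, m n ≤ B) {p : ℝ}
    (hp0 : 0 < p) (hp : p < 1 / 2) :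
    ∃ C : ℝ, 0 ≤ C ∧ ∀ L A n : ℕ, Mprod m A ∣ n → n < Mprod m L → A ≤ L →
      meanPow p L (fejerSum m n) ≤ C * (Mprod m A : ℝ) ^ (2 * p - 1) := by
  have hp1 : p < 1 := by linarith
  obtain ⟨C, hC0, hC⟩ := meanPow_Dker_le hm hB hp0 hp1
  obtain ⟨C', hC0', hC'⟩ := meanPow_fejerSum_Mprod_le hm hB hp0 hp
  have hr : 2 * p - 1 < 0 := by linarith
  have h2 := one_sub_two_rpow_pos hr
  set K : ℝ := B ^ p * C + (B * C + B * C')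
  refine ⟨K / (1 - 2 ^ (2 * p - 1)), by positivity, ?_⟩
  intro L A n hn hnL hA
  induction hA using Nat.decreasingInduction generalizing n with
  | self =>
    rw [Nat.eq_zero_of_dvd_of_lt hn hnL, meanPow_fejerSum_zero hp0]
    positivity
  | of_succ A hA ih =>
    obtain ⟨q, b, hq, hb, rfl⟩ := exists_eq_add_mul_Mprod hn
    have hbM : b * Mprod m A ≤ Mprod m (A + 1) := Nat.mul_le_mul_right _ hb.le
    have hM : (0 : ℝ) < Mprod m A := by exact_mod_cast Mprod_pos A
    have hbB : b ≤ B := hb.le.trans (hB A)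
    have h1 : fejerSum m (q + b * Mprod m A) = fun x => (fejerSum m q x +
        (b * Mprod m A : ℕ) * Dker m q x) +
        psi m q x * (∑ c ∈ Finset.range b, (Mprod m A : ℂ) * Dker m (c * Mprod m A) x +
          (∑ c ∈ Finset.range b, rad m A x ^ c) * fejerSum m (Mprod m A) x) :=
      funext fun x => by rw [fejerSum_add hm hq hbM, fejerSum_mul_Mprod hm hb.le]
    have hD : meanPow p L (fun x => (b * Mprod m A : ℕ) * Dker m q x) ≤
        B ^ p * C * (Mprod m A : ℝ) ^ (2 * p - 1) := by
      rw [meanPow_natCast_mul, Nat.cast_mul, Real.mul_rpow (by positivity) hM.le,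
        show 2 * p - 1 = p + (p - 1) by ring, Real.rpow_add hM,
        show (B : ℝ) ^ p * C * ((Mprod m A : ℝ) ^ p * (Mprod m A : ℝ) ^ (p - 1)) =
          (B : ℝ) ^ p * (Mprod m A : ℝ) ^ p * (C * (Mprod m A : ℝ) ^ (p - 1)) by ring]
      refine mul_le_mul ?_ (hC L A q ((Mprod_dvd (Nat.le_succ A)).trans hq) (by omega) hA.le)
        (meanPow_nonneg _ _ _) (by positivity)
      gcongr
    have hF : meanPow p L (fun x => (∑ c ∈ Finset.range b, rad m A x ^ c) *
        fejerSum m (Mprod m A) x) ≤ B * C' * (Mprod m A : ℝ) ^ (2 * p - 1) := by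
      refine (meanPow_sum_rad_le hp0 hp1.le L A b _).trans ?_
      rw [mul_assoc]
      exact mul_le_mul (by exact_mod_cast hbB) (hC' L A hA.le) (meanPow_nonneg _ _ _)
        (Nat.cast_nonneg _)
    have hS := meanPow_sum_Dker_le hp0 hp1.le hb.le hbB hA hC0
      fun q hq hqL => hC L A q hq hqL hA.le
    have hstep := le_of_geometric_step (C := K / (1 - 2 ^ (2 * p - 1))) (K := K)
      (by field_simp) (by positivity) (Mprod_succ_rpow_le hm hr.le A)
    have hih := ih q hq (by omega)
    rw [h1]
    refine (meanPow_add_le hp0.le hp1.le L _ _).trans ?_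
    rw [meanPow_unimodular_mul p L (norm_psi q)]
    have hadd₁ := meanPow_add_le hp0.le hp1.le L (fejerSum m q)
      (fun x => (b * Mprod m A : ℕ) * Dker m q x)
    have hadd₂ := meanPow_add_le hp0.le hp1.le L
      (fun x => ∑ c ∈ Finset.range b, (Mprod m A : ℂ) * Dker m (c * Mprod m A) x)
      (fun x => (∑ c ∈ Finset.range b, rad m A x ^ c) * fejerSum m (Mprod m A) x)
    have hK : K * (Mprod m A : ℝ) ^ (2 * p - 1) = B ^ p * C * (Mprod m A : ℝ) ^ (2 * p - 1) +
        (B * C * (Mprod m A : ℝ) ^ (2 * p - 1) + B * C' * (Mprod m A : ℝ) ^ (2 * p - 1)) := by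
      simp only [K]
      ring
    linarith

end KernelBounds

section Cylinders

variable {m}

instance (k : ℕ) : DiscreteMeasurableSpace (ZMod k) := ⟨fun _ => trivial⟩

/-- Restriction to the first `L` coordinates. -/
def restrictFin (L : ℕ) (x : G m) : ∀ j : Fin L, ZMod (m j) := fun j => x j

lemma measurable_restrictFin (L : ℕ) : Measurable (restrictFin (m := m) L) :=
  measurable_pi_lambda _ fun _ => measurable_pi_apply _

lemma extendZero_restrictFin {L j : ℕ} (hj : j < L) (x : G m) :
    extendZero L (restrictFin L x) j = x j := extendZero_of_lt hj _

lemma cylinder_extendZero (L : ℕ) (z : ∀ j : Fin L, ZMod (m j)) :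
    cylinder m L (extendZero L z) = restrictFin L ⁻¹' {z} := by
  ext x
  constructor
  · intro hx
    funext j
    exact (hx j j.2).trans (extendZero_of_lt j.2 z)
  · rintro rfl j hj
    exact (extendZero_restrictFin hj x).symm

lemma filtr_le (L : ℕ) : filtr m L ≤ MeasurableSpace.pi := (measurable_restrictFin L).comap_le

lemma eq_of_measurable_filtr {L : ℕ} {g : G m → ℂ} (hg : Measurable[filtr m L] g) {x y : G m}
    (hxy : ∀ j < L, x j = y j) : g x = g y := by
  obtain ⟨S, -, hS⟩ := hg (measurableSet_singleton (g x))
  have hx : restrictFin L x ∈ S :=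
    Set.mem_preimage.1 (hS.symm ▸ Set.mem_preimage.2 (Set.mem_singleton _))
  have hxy' : restrictFin L x = restrictFin L y := funext fun j => hxy j j.2
  rw [hxy'] at hx
  have hy : y ∈ g ⁻¹' {g x} := hS ▸ hx
  exact (Set.mem_singleton_iff.1 hy).symm

variable [∀ n, NeZero (m n)]

lemma measurableSet_filtr_cylinder {L k : ℕ} (hk : L ≤ k) (z : ∀ j : Fin L, ZMod (m j)) :
    MeasurableSet[filtr m k] (cylinder m L (extendZero L z)) := by
  rw [cylinder_extendZero]
  exact ⟨{w | (fun j : Fin L => w (Fin.castLE hk j)) = z}, Set.Finite.measurableSet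
    (Set.toFinite _), rfl⟩

lemma measurableSet_cylinder (L : ℕ) (z : ∀ j : Fin L, ZMod (m j)) :
    MeasurableSet (cylinder m L (extendZero L z)) :=
  filtr_le L _ (measurableSet_filtr_cylinder le_rfl z)

lemma lintegral_eq_sum {μ : Measure (G m)} (hμ : IsVilenkinMeasure m μ) {L : ℕ}
    {F : G m → ℝ≥0∞} (hF : ∀ x y, (∀ j < L, x j = y j) → F x = F y) :
    ∫⁻ x, F x ∂μ = (Mprod m L : ℝ≥0∞)⁻¹ *
      ∑ z : (∀ j : Fin L, ZMod (m j)), F (extendZero L z) := by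
  have h1 : ∀ x, F x = F (extendZero L (restrictFin L x)) := fun x =>
    hF _ _ fun j hj => (extendZero_restrictFin hj x).symm
  rw [lintegral_congr h1, ← lintegral_map (f := fun z => F (extendZero L z))
    (measurable_of_finite _) (measurable_restrictFin L), lintegral_fintype, Finset.mul_sum]
  refine Finset.sum_congr rfl fun z _ => ?_
  rw [Measure.map_apply (measurable_restrictFin L) (measurableSet_singleton z),
    ← cylinder_extendZero, hμ.2, mul_comm]

lemma integral_mul_eq_sum {μ : Measure (G m)} {L : ℕ} {h g : G m → ℂ} (hh : Integrable h μ)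
    (hg : ∀ x y, (∀ j < L, x j = y j) → g x = g y) :
    ∫ x, h x * g x ∂μ = ∑ z : (∀ j : Fin L, ZMod (m j)),
      (∫ x in cylinder m L (extendZero L z), h x ∂μ) * g (extendZero L z) := by
  have h1 : ∀ x, h x * g x = ∑ z : (∀ j : Fin L, ZMod (m j)),
      (cylinder m L (extendZero L z)).indicator (fun x => h x * g (extendZero L z)) x := by
    intro x
    rw [Finset.sum_eq_single (restrictFin L x)]
    · rw [cylinder_extendZero, Set.indicator_of_mem (Set.mem_preimage.2 (Set.mem_singleton _)),
        hg _ _ fun j hj => extendZero_restrictFin hj x]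
    · intro z _ hz
      rw [cylinder_extendZero, Set.indicator_of_notMem]
      exact fun hx => hz (Set.mem_singleton_iff.1 hx).symm
    · exact fun hx => absurd (Finset.mem_univ _) hx
  rw [integral_congr_ae (ae_of_all _ h1), integral_finsetSum _ fun z _ =>
    (hh.mul_const _).indicator (measurableSet_cylinder L z)]
  refine Finset.sum_congr rfl fun z _ => ?_
  rw [integral_indicator (measurableSet_cylinder L z), integral_mul_const]

end Cylinders

section Martingales

variable {m} [∀ n, NeZero (m n)] {μ : Measure (G m)} {f : ℕ → G m → ℂ}

lemma setIntegral_cylinder_martingale (hμ : IsVilenkinMeasure m μ) (hf : IsMartingale m μ f)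
    {L k : ℕ} (hk : L ≤ k) (z : ∀ j : Fin L, ZMod (m j)) :
    ∫ x in cylinder m L (extendZero L z), f k x ∂μ =
      (Mprod m L : ℂ)⁻¹ * f L (extendZero L z) := by
  induction k, hk using Nat.le_induction with
  | base =>
    rw [setIntegral_congr_fun (g := fun _ => f L (extendZero L z)) (measurableSet_cylinder L z)
      fun x hx => eq_of_measurable_filtr (hf.2.1 L) hx, setIntegral_const, measureReal_def,
      hμ.2]
    simp
  | succ k hk ih => rw [hf.2.2 k _ (measurableSet_filtr_cylinder hk z), ih]

lemma martCoeff_eq_sum (hm : ∀ n, 2 ≤ m n) (hμ : IsVilenkinMeasure m μ)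
    (hf : IsMartingale m μ f) {L i : ℕ} (hi : i < Mprod m L) :
    martCoeff m μ f i = (Mprod m L : ℂ)⁻¹ * ∑ z : (∀ j : Fin L, ZMod (m j)),
      f L (extendZero L z) * (starRingEnd ℂ) (psi m i (extendZero L z)) := by
  refine (tendsto_atTop_of_eventually_const (i₀ := L) fun k hk => ?_).limUnder_eq
  rw [integral_mul_eq_sum (L := L) (hf.1 k) fun x y hxy => by rw [psi_congr hm hi hxy],
    Finset.mul_sum]
  exact Finset.sum_congr rfl fun z _ => by
    rw [setIntegral_cylinder_martingale hμ hf hk z, mul_assoc]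

lemma sigmaMart_eq_sum (hm : ∀ n, 2 ≤ m n) (hμ : IsVilenkinMeasure m μ)
    (hf : IsMartingale m μ f) {L n : ℕ} (hn : n ≤ Mprod m L) (x : G m) :
    sigmaMart m μ f n x = ((n : ℂ)⁻¹ * (Mprod m L : ℂ)⁻¹) *
      ∑ z : (∀ j : Fin L, ZMod (m j)), f L (extendZero L z) *
        fejerSum m n (x - extendZero L z) := by
  have hS : ∀ k ≤ n, SMart m μ f k x = (Mprod m L : ℂ)⁻¹ *
      ∑ z : (∀ j : Fin L, ZMod (m j)), f L (extendZero L z) *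
        Dker m k (x - extendZero L z) := by
    intro k hk
    simp only [SMart, Dker, Finset.mul_sum]
    rw [Finset.sum_comm]
    refine Finset.sum_congr rfl fun i hi => ?_
    have hi' : i < Mprod m L := (Finset.mem_range.1 hi).trans_le (hk.trans hn)
    rw [martCoeff_eq_sum hm hμ hf hi', mul_assoc, Finset.sum_mul, Finset.mul_sum]
    refine Finset.sum_congr rfl fun z _ => ?_
    rw [psi_sub]
    ring
  rw [sigmaMart, mul_assoc,
    Finset.sum_congr rfl fun k hk => hS k (Finset.mem_range.1 hk).le, ← Finset.mul_sum,
    Finset.sum_comm]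
  simp only [fejerSum, Finset.mul_sum]

lemma sigmaMart_congr (hm : ∀ n, 2 ≤ m n) (hμ : IsVilenkinMeasure m μ)
    (hf : IsMartingale m μ f) {L n : ℕ} (hn : n ≤ Mprod m L) {x y : G m}
    (hxy : ∀ j < L, x j = y j) : sigmaMart m μ f n x = sigmaMart m μ f n y := by
  rw [sigmaMart_eq_sum hm hμ hf hn, sigmaMart_eq_sum hm hμ hf hn]
  congr 1
  refine Finset.sum_congr rfl fun z _ => ?_
  have hz : ∀ j < L, (x - extendZero L z) j = (y - extendZero L z) j := fun j hj => by
    rw [Pi.sub_apply, Pi.sub_apply, hxy j hj]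
  rw [fejerSum_congr hm hn hz]

lemma meanPow_sigmaMart_le (hm : ∀ n, 2 ≤ m n) (hμ : IsVilenkinMeasure m μ)
    (hf : IsMartingale m μ f) {p : ℝ} (hp0 : 0 < p) (hp1 : p ≤ 1) {L n : ℕ}
    (hn : n ≤ Mprod m L) :
    meanPow p L (sigmaMart m μ f n) ≤ (n : ℝ)⁻¹ ^ p * (Mprod m L : ℝ) ^ (1 - p) *
      meanPow p L (fejerSum m n) * meanPow p L (f L) := by
  have hM : (0 : ℝ) < Mprod m L := by exact_mod_cast Mprod_pos L
  have hpt : ∀ x, ‖sigmaMart m μ f n x‖ ^ p ≤ ((n : ℝ)⁻¹ ^ p * (Mprod m L : ℝ)⁻¹ ^ p) *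
      ∑ z : (∀ j : Fin L, ZMod (m j)), ‖f L (extendZero L z)‖ ^ p *
        ‖fejerSum m n (x - extendZero L z)‖ ^ p := by
    intro x
    rw [sigmaMart_eq_sum hm hμ hf hn, norm_mul, norm_mul, norm_inv, norm_inv,
      Complex.norm_natCast, Complex.norm_natCast, Real.mul_rpow (by positivity) (by positivity),
      Real.mul_rpow (by positivity) (by positivity)]
    gcongr
    refine (norm_sum_rpow_le hp0 hp1 _ _).trans_eq ?_
    simp only [norm_mul, Real.mul_rpow (norm_nonneg _) (norm_nonneg _)]
  refine (avg_mono hpt).trans_eq ?_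
  rw [avg_const_mul, avg_sum]
  have htr : ∀ z : (∀ j : Fin L, ZMod (m j)),
      avg L (fun x => ‖f L (extendZero L z)‖ ^ p * ‖fejerSum m n (x - extendZero L z)‖ ^ p) =
        ‖f L (extendZero L z)‖ ^ p * meanPow p L (fejerSum m n) := by
    intro z
    rw [avg_const_mul, meanPow]
    simp only [sub_eq_add_neg]
    rw [avg_translate (y := -extendZero L z) (fun j hj => by
      rw [Pi.neg_apply, extendZero_of_le hj, neg_zero]) fun x => ‖fejerSum m n x‖ ^ p]
  rw [Finset.sum_congr rfl fun z _ => htr z, ← Finset.sum_mul, meanPow.eq_1 p L (f L), avg,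
    Real.inv_rpow hM.le, Real.rpow_sub hM, Real.rpow_one]
  field_simp

lemma lintegral_enorm_rpow_eq (hμ : IsVilenkinMeasure m μ) {p : ℝ} (hp0 : 0 < p) {L : ℕ}
    {g : G m → ℂ} (hg : ∀ x y, (∀ j < L, x j = y j) → g x = g y) :
    ∫⁻ x, ‖g x‖ₑ ^ p ∂μ = ENNReal.ofReal (meanPow p L g) := by
  have hM : (0 : ℝ) < Mprod m L := by exact_mod_cast Mprod_pos L
  rw [lintegral_eq_sum hμ (fun x y hxy => by rw [hg x y hxy]), meanPow, avg,
    ENNReal.ofReal_mul (by positivity), ENNReal.ofReal_inv_of_pos hM, ENNReal.ofReal_natCast,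
    ENNReal.ofReal_sum_of_nonneg fun _ _ => by positivity]
  congr 1
  refine Finset.sum_congr rfl fun z _ => ?_
  rw [← ENNReal.ofReal_rpow_of_nonneg (norm_nonneg _) hp0.le, ofReal_norm]

lemma meanPow_le_hardyNorm (hμ : IsVilenkinMeasure m μ) (hf : IsMartingale m μ f) {p : ℝ}
    (hp0 : 0 < p) (L : ℕ) :
    ENNReal.ofReal (meanPow p L (f L)) ^ (1 / p) ≤ hardyNorm m p μ f := by
  rw [← lintegral_enorm_rpow_eq hμ hp0 fun x y => eq_of_measurable_filtr (hf.2.1 L), hardyNorm]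
  gcongr with x
  exact le_iSup (fun n => (‖f n x‖₊ : ℝ≥0∞)) L

end Martingales

/-- Theorem 1(a): for `0 < p < 1/2` there is a constant `c_p > 0` such that for every
martingale `f ∈ H_p` and every positive integer `n`,
`‖σ_n f‖_{L_p} ≤ c_p (M_{|n|}/M_{⟨n⟩})^{1/p-2} ‖f‖_{H_p}`. -/
theorem fejer_subsequence_bound
    (m : ℕ → ℕ) (hm : ∀ n, 2 ≤ m n) (hbdd : ∃ B, ∀ n, m n ≤ B)
    (μ : Measure (G m)) (hμ : IsVilenkinMeasure m μ)
    (p : ℝ) (hp0 : 0 < p) (hp : p < 1 / 2) :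
    ∃ c : ℝ≥0, 0 < c ∧
      ∀ f : ℕ → G m → ℂ, IsMartingale m μ f → hardyNorm m p μ f < ⊤ →
        ∀ n : ℕ, 0 < n →
          eLpNorm (sigmaMart m μ f n) (ENNReal.ofReal p) μ ≤
            (c : ℝ≥0∞) *
              ((Mprod m (highIdx m n) : ℝ≥0∞) / (Mprod m (lowIdx m n) : ℝ≥0∞)) ^ (1 / p - 2) *
              hardyNorm m p μ f := by
  have : ∀ n, NeZero (m n) := fun n => ⟨by have := hm n; omega⟩
  obtain ⟨B, hB⟩ := hbdd
  obtain ⟨C, hC0, hC⟩ := meanPow_fejerSum_le hm hB hp0 hp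
  set K : ℝ := (B : ℝ) ^ (1 - p) * C + 1
  have hK : 0 < K := by positivity
  refine ⟨K.toNNReal ^ (1 / p), NNReal.rpow_pos (Real.toNNReal_pos.2 hK), ?_⟩
  intro f hf _ n hn
  obtain ⟨hrn, hnL⟩ := Mprod_highIdx hm hn
  set r := highIdx m n
  set s := lowIdx m n
  have hdvd : Mprod m s ∣ n := Mprod_lowIdx_dvd n
  have hsr : s ≤ r + 1 := by
    by_contra! h
    exact absurd (Nat.le_of_dvd hn hdvd) (not_le.2 (hnL.trans_le (Mprod_le h.le)))
  have hr0 : (0 : ℝ) < Mprod m r := by exact_mod_cast Mprod_pos r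
  have hs0 : (0 : ℝ) < Mprod m s := by exact_mod_cast Mprod_pos s
  have hF0 := meanPow_nonneg p (r + 1) (f (r + 1))
  have hreal : meanPow p (r + 1) (sigmaMart m μ f n) ≤
      K * ((Mprod m r : ℝ) / Mprod m s) ^ (1 - 2 * p) * meanPow p (r + 1) (f (r + 1)) := by
    refine (meanPow_sigmaMart_le hm hμ hf hp0 (by linarith) hnL.le).trans ?_
    refine mul_le_mul_of_nonneg_right ?_ hF0
    have h1 : (n : ℝ)⁻¹ ^ p ≤ (Mprod m r : ℝ) ^ (-p) := by
      rw [Real.rpow_neg hr0.le, ← Real.inv_rpow hr0.le]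
      gcongr
    have h2 : (Mprod m (r + 1) : ℝ) ^ (1 - p) ≤ (B : ℝ) ^ (1 - p) * (Mprod m r : ℝ) ^ (1 - p) := by
      rw [Mprod_succ, Nat.cast_mul, Real.mul_rpow (by positivity) (by positivity)]
      have hp' : 0 ≤ 1 - p := by linarith
      gcongr
      exact hB r
    have h3 := hC (r + 1) s n hdvd hnL hsr
    calc (n : ℝ)⁻¹ ^ p * (Mprod m (r + 1) : ℝ) ^ (1 - p) * meanPow p (r + 1) (fejerSum m n)
        ≤ (Mprod m r : ℝ) ^ (-p) * ((B : ℝ) ^ (1 - p) * (Mprod m r : ℝ) ^ (1 - p)) *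
            (C * (Mprod m s : ℝ) ^ (2 * p - 1)) :=
          mul_le_mul (mul_le_mul h1 h2 (by positivity) (by positivity)) h3
            (meanPow_nonneg _ _ _) (by positivity)
      _ = (B : ℝ) ^ (1 - p) * C * ((Mprod m r : ℝ) / Mprod m s) ^ (1 - 2 * p) := by
          rw [Real.div_rpow hr0.le hs0.le, div_eq_mul_inv, ← Real.rpow_neg hs0.le,
            show 1 - 2 * p = -p + (1 - p) by ring, Real.rpow_add hr0,
            show -(-p + (1 - p)) = 2 * p - 1 by ring]
          ring
      _ ≤ K * ((Mprod m r : ℝ) / Mprod m s) ^ (1 - 2 * p) :=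
          mul_le_mul_of_nonneg_right (by simp [K]) (by positivity)
  rw [eLpNorm_eq_lintegral_rpow_enorm_toReal (by simpa using hp0) ENNReal.ofReal_ne_top,
    ENNReal.toReal_ofReal hp0.le,
    lintegral_enorm_rpow_eq hμ hp0 fun x y => sigmaMart_congr hm hμ hf hnL.le]
  have hp' : 0 ≤ 1 / p := by positivity
  refine (ENNReal.rpow_le_rpow (ENNReal.ofReal_le_ofReal hreal) hp').trans ?_
  rw [ENNReal.ofReal_mul (by positivity), ENNReal.ofReal_mul hK.le,
    ENNReal.mul_rpow_of_nonneg _ _ hp', ENNReal.mul_rpow_of_nonneg _ _ hp']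
  refine mul_le_mul' (le_of_eq ?_) (meanPow_le_hardyNorm hμ hf hp0 (r + 1))
  congr 1
  · rw [ENNReal.coe_rpow_of_nonneg _ hp']
    rfl
  · rw [← ENNReal.ofReal_rpow_of_pos (by positivity), ← ENNReal.rpow_mul,
      ENNReal.ofReal_div_of_pos hs0, ENNReal.ofReal_natCast, ENNReal.ofReal_natCast]
    congr 1
    field_simp

end Vilenkin
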